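/- For all natural numbers n and k with k ≤ n, the following identity of polynomials in c and d holds: (n+1) · P_{n,k}(c,d) = (k+1) · Σ_{l=0}^{n-k} C(n+1, l) · C(l, 2l−n+k) · d^{2l−n+k} · c^{n−k−l}, where P_{n,k}(c,d) = Σ over Motzkin prefixes of length n and final height k of c^{(number of down steps)} · d^{(number of level steps)}, C(·,·) is the binomial coefficient (zero on negative arguments), and the sum ranges over those l for which 2l−n+k ≥ 0. -/

import Mathlib

open Finset

inductive Step : Type
  | U | L | D
deriving DecidableEq

instance : Fintype Step where
  elems := ⟨[Step.U, Step.L, Step.D], by decide⟩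
  complete := by intro x; cases x <;> decide

/-- The vertical displacement of a step: up = +1, level = 0, down = -1. -/
def Step.val : Step → ℤ
  | .U => 1
  | .L => 0
  | .D => -1

/-- The partial sum of the step values of the first `i` steps;
this is the height at which step `i` starts. -/
def hsum {n : ℕ} (P : Fin n → Step) (i : ℕ) : ℤ :=
  ∑ j ∈ Finset.univ.filter (fun j : Fin n => (j : ℕ) < i), (P j).val

/-- A Motzkin path: all partial sums nonnegative and total sum 0. -/
abbrev IsMotzkin {n : ℕ} (P : Fin n → Step) : Prop :=
  (∀ i : Fin (n+1), 0 ≤ hsum P (i : ℕ)) ∧ hsum P n = 0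

/-- A Motzkin prefix of final height `k`: all partial sums nonnegative, total sum `k`. -/
abbrev IsMPrefix {n : ℕ} (P : Fin n → Step) (k : ℕ) : Prop :=
  (∀ i : Fin (n+1), 0 ≤ hsum P (i : ℕ)) ∧ hsum P n = (k : ℤ)

/-- `[h]_q = 1 + q + ... + q^(h-1)`. -/
def geo {R : Type*} [CommSemiring R] (q : R) (h : ℤ) : R :=
  ∑ i ∈ Finset.range h.toNat, q ^ i

/-- The Gaussian (q-)binomial coefficient, via the q-Pascal recurrence. -/
def qbinom {R : Type*} [CommSemiring R] (q : R) : ℕ → ℕ → R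
  | _, 0 => 1
  | 0, _+1 => 0
  | n+1, k+1 => qbinom q n k + q ^ (k+1) * qbinom q n (k+1)

/-- The binomial coefficient with integer lower argument, zero on negative arguments. -/
def ch (m : ℕ) (j : ℤ) : ℤ := if 0 ≤ j then m.choose j.toNat else 0


def TT : ℕ → ℕ → ℕ → ℕ
  | 0, k, m => if k = 0 ∧ m = 0 then 1 else 0
  | n+1, k, m => (if k = 0 then 0 else TT n (k-1) m) + TT n k m
      + (if m = 0 then 0 else TT n (k+1) (m-1))

lemma TT_zero (n : ℕ) : ∀ k m, n < k + 2*m → TT n k m = 0 := by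
  induction n with
  | zero => intro k m h; simp only [TT]; rw [if_neg]; omega
  | succ n ih =>
    intro k m h
    simp only [TT]
    rw [ih k m (by omega)]
    split_ifs with h1 h2 h2
    · rfl
    · rw [ih _ _ (by omega)]
    · rw [ih _ _ (by omega)]
    · rw [ih _ _ (by omega), ih _ _ (by omega)]

lemma TT_closed (n : ℕ) : ∀ k m j, n = k + 2*m + j →
    TT n k m * ((k+m+1).factorial * j.factorial * m.factorial) = n.factorial * (k+1) := by
  induction n with
  | zero =>
    intro k m j h
    obtain rfl : k = 0 := by omega
    obtain rfl : m = 0 := by omega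
    obtain rfl : j = 0 := by omega
    simp [TT]
  | succ n ih =>
    intro k m j h
    simp only [TT]
    have A : (if k = 0 then 0 else TT n (k-1) m) * ((k+m+1).factorial * j.factorial * m.factorial)
        = n.factorial * k * (k+m+1) := by
      rcases k with _ | k
      · simp
      · have := ih k m j (by omega)
        simp only [Nat.add_eq_zero_iff, one_ne_zero, and_false, if_false, Nat.add_sub_cancel]
        rw [show k + 1 + m + 1 = (k+m+1)+1 by ring, Nat.factorial_succ (k+m+1), ← this]
        ring
    have B : TT n k m * ((k+m+1).factorial * j.factorial * m.factorial)
        = n.factorial * (k+1) * j := by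
      rcases j with _ | j
      · rw [TT_zero n k m (by omega)]; simp
      · have := ih k m j (by omega)
        rw [Nat.factorial_succ j, ← this]
        ring
    have C : (if m = 0 then 0 else TT n (k+1) (m-1)) *
        ((k+m+1).factorial * j.factorial * m.factorial)
        = n.factorial * (k+2) * m := by
      rcases m with _ | m
      · simp
      · have := ih (k+1) m j (by omega)
        simp only [Nat.add_eq_zero_iff, one_ne_zero, and_false, if_false, Nat.add_sub_cancel]
        rw [show k + (m + 1) + 1 = k+1+m+1 by ring, Nat.factorial_succ m,
          ← show k + 1 + 1 = k + 2 by ring, ← this]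
        ring
    rw [add_mul, add_mul, A, B, C, Nat.factorial_succ, h]
    ring

lemma TT_choose (n k m l : ℕ) (h1 : k + 2*m ≤ n) (hl : l + k + m = n) :
    (n+1) * TT n k m = (k+1) * ((n+1).choose l * l.choose (2*l+k-n)) := by
  obtain ⟨j, rfl⟩ := Nat.exists_eq_add_of_le h1
  obtain rfl : l = m + j := by omega
  have e : 2 * (m+j) + k - (k + 2*m + j) = j := by omega
  rw [e]
  have c := TT_closed _ k m j rfl
  have c1 := Nat.choose_mul_factorial_mul_factorial (show m + j ≤ k+2*m+j+1 by omega)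
  have c2 := Nat.choose_mul_factorial_mul_factorial (show j ≤ m + j by omega)
  rw [show k+2*m+j+1-(m+j) = k+m+1 by omega, Nat.factorial_succ (k+2*m+j)] at c1
  rw [show m + j - j = m by omega] at c2
  have hp : 0 < (k+m+1).factorial * j.factorial * m.factorial := by positivity
  apply Nat.eq_of_mul_eq_mul_right hp
  rw [mul_assoc, c]
  rw [← c2] at c1
  calc _ = (k+1) * ((k + 2 * m + j + 1) * (k + 2 * m + j).factorial) := by ring
    _ = _ := by rw [← c1]; ring

section
variable {R : Type*} [CommRing R]

def wt (c d : R) : Step → R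
  | .U => 1
  | .L => d
  | .D => c

def SS (c d : R) (n : ℕ) (k : ℤ) : R :=
  ∑ P : Fin n → Step, if (∀ i : Fin (n+1), 0 ≤ hsum P (i : ℕ)) ∧ hsum P n = k
    then ∏ i, wt c d (P i) else 0

lemma hsum_snoc_le {n : ℕ} (P : Fin n → Step) (s : Step) (i : ℕ) (hi : i ≤ n) :
    hsum (Fin.snoc P s : Fin (n+1) → Step) i = hsum P i := by
  unfold hsum
  rw [Finset.sum_filter, Finset.sum_filter, Fin.sum_univ_castSucc]
  simp [show ¬ n < i by omega]

lemma hsum_snoc_last {n : ℕ} (P : Fin n → Step) (s : Step) :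
    hsum (Fin.snoc P s : Fin (n+1) → Step) (n+1) = hsum P n + s.val := by
  unfold hsum
  rw [Finset.sum_filter, Finset.sum_filter, Fin.sum_univ_castSucc]
  simp [Nat.lt_succ_of_lt]

lemma SS_neg (c d : R) (n : ℕ) (k : ℤ) (hk : k < 0) : SS c d n k = 0 := by
  unfold SS
  apply Finset.sum_eq_zero
  intro P _
  rw [if_neg]
  rintro ⟨h1, h2⟩
  have := h1 (Fin.last n)
  simp only [Fin.val_last] at this
  omega

lemma cond_snoc {n : ℕ} (P : Fin n → Step) (s : Step) (k : ℤ) (hk : 0 ≤ k) :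
    ((∀ i : Fin (n+1+1), 0 ≤ hsum (Fin.snoc P s : Fin (n+1) → Step) (i : ℕ)) ∧
      hsum (Fin.snoc P s : Fin (n+1) → Step) (n+1) = k) ↔
    ((∀ i : Fin (n+1), 0 ≤ hsum P (i : ℕ)) ∧ hsum P n = k - s.val) := by
  rw [Fin.forall_fin_succ', hsum_snoc_last]
  have : ∀ i : Fin (n+1), hsum (Fin.snoc P s : Fin (n+1) → Step) (i.castSucc : ℕ)
      = hsum P i := fun i => hsum_snoc_le P s i (by omega)
  simp only [this, Fin.val_last, hsum_snoc_last]
  constructor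
  · rintro ⟨⟨h1, h2⟩, h3⟩
    exact ⟨h1, by omega⟩
  · rintro ⟨h1, h2⟩
    exact ⟨⟨h1, by omega⟩, by omega⟩

lemma SS_succ (c d : R) (n : ℕ) (k : ℤ) (hk : 0 ≤ k) :
    SS c d (n+1) k = SS c d n (k-1) + d * SS c d n k + c * SS c d n (k+1) := by
  have key : SS c d (n+1) k = ∑ s : Step, wt c d s * SS c d n (k - s.val) := by
    unfold SS
    rw [← (Fin.snocEquiv (fun _ : Fin (n+1) => Step)).sum_comp, Fintype.sum_prod_type]
    apply Finset.sum_congr rfl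
    intro s _
    rw [Finset.mul_sum]
    apply Finset.sum_congr rfl
    intro P _
    have e : (Fin.snocEquiv (fun _ : Fin (n+1) => Step)) (s, P)
      = (Fin.snoc P s : Fin (n+1) → Step) := rfl
    rw [e]
    simp only [cond_snoc P s k hk, Fin.prod_univ_castSucc, Fin.snoc_castSucc, Fin.snoc_last]
    split_ifs
    · ring
    · ring
  rw [key]
  have hu : (Finset.univ : Finset Step) = {Step.U, Step.L, Step.D} := by decide
  rw [hu, Finset.sum_insert (by decide), Finset.sum_insert (by decide), Finset.sum_singleton]
  simp only [wt, Step.val]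
  rw [sub_zero, sub_neg_eq_add]
  ring

lemma SS_eq (c d : R) (n : ℕ) : ∀ k : ℕ,
    SS c d n k = ∑ m ∈ range (n+1), (TT n k m : R) * (c^m * d^(n-k-2*m)) := by
  induction n with
  | zero =>
    intro k
    simp [SS, TT, hsum, eq_comm]
  | succ n ih =>
    intro k
    rw [SS_succ c d n k (by positivity)]
    have A : SS c d n ((k:ℤ)-1) = ∑ m ∈ range (n+1+1),
        ((if k = 0 then 0 else TT n (k-1) m : ℕ) : R) * (c^m * d^(n+1-k-2*m)) := by
      rcases k with _ | k
      · rw [SS_neg _ _ _ _ (by simp)]; simp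
      · rw [show ((k+1:ℕ):ℤ)-1 = k by push_cast; ring, ih k, Finset.sum_range_succ _ (n+1)]
        simp [TT_zero n k (n+1) (by omega)]
    have B : d * SS c d n k = ∑ m ∈ range (n+1+1),
        (TT n k m : R) * (c^m * d^(n+1-k-2*m)) := by
      rw [ih k, Finset.sum_range_succ _ (n+1), TT_zero n k (n+1) (by omega), Finset.mul_sum]
      simp only [Nat.cast_zero, zero_mul, add_zero]
      apply Finset.sum_congr rfl
      intro m _
      by_cases h : k + 2*m ≤ n
      · rw [show n+1-k-2*m = (n-k-2*m)+1 by omega]; ring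
      · rw [TT_zero n k m (by omega)]; simp
    have C : c * SS c d n ((k:ℤ)+1) = ∑ m ∈ range (n+1+1),
        ((if m = 0 then 0 else TT n (k+1) (m-1) : ℕ) : R) * (c^m * d^(n+1-k-2*m)) := by
      rw [show ((k:ℤ)+1) = ((k+1:ℕ):ℤ) by push_cast; ring, ih (k+1),
        Finset.sum_range_succ' _ (n+1), Finset.mul_sum]
      simp only [Nat.add_eq_zero_iff, one_ne_zero, and_false, if_false, Nat.add_sub_cancel,
        if_true, Nat.cast_zero, zero_mul, add_zero]
      apply Finset.sum_congr rfl
      intro m _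
      rw [show n+1-k-2*(m+1) = n-(k+1)-2*m by omega]; ring
    rw [A, B, C, ← Finset.sum_add_distrib, ← Finset.sum_add_distrib]
    apply Finset.sum_congr rfl
    intro m _
    simp only [TT]
    push_cast
    ring

lemma wt_prod (c d : R) {n : ℕ} (P : Fin n → Step) :
    ∏ i, wt c d (P i) = c ^ (Finset.univ.filter (fun i => P i = Step.D)).card *
      d ^ (Finset.univ.filter (fun i => P i = Step.L)).card := by
  rw [← Finset.prod_const, ← Finset.prod_const, Finset.prod_filter, Finset.prod_filter,
    ← Finset.prod_mul_distrib]
  apply Finset.prod_congr rfl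
  intro i _
  cases P i <;> simp [wt]

lemma main_aux (c d : R) (n k : ℕ) (hk : k ≤ n) :
    ((n : R) + 1) * SS c d n k = ((k : R) + 1) *
      ∑ l ∈ (Finset.range (n-k+1)).filter (fun l => n ≤ 2*l + k),
        ((n+1).choose l : R) * (l.choose (2*l + k - n) : R) *
        d ^ (2*l + k - n) * c ^ (n - k - l) := by
  rw [SS_eq, Finset.sum_filter]
  have h1 : ∑ m ∈ range (n+1), (TT n k m : R) * (c^m * d^(n-k-2*m))
      = ∑ m ∈ range (n-k+1), (TT n k m : R) * (c^m * d^(n-k-2*m)) := by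
    symm
    apply Finset.sum_subset
    · intro x; simp only [Finset.mem_range]; omega
    · intro x _ h2
      simp only [Finset.mem_range] at h2
      rw [TT_zero n k x (by omega)]; simp
  rw [h1, ← Finset.sum_range_reflect, Finset.mul_sum, Finset.mul_sum]
  apply Finset.sum_congr rfl
  intro l hl
  simp only [Finset.mem_range] at hl
  rw [show n - k + 1 - 1 - l = n - k - l by omega]
  split_ifs with h
  · have := congrArg (Nat.cast : ℕ → R) (TT_choose n k (n-k-l) l (by omega) (by omega))
    push_cast at this
    rw [show n - k - 2*(n-k-l) = 2*l+k-n by omega, ← mul_assoc, this]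
    ring
  · rw [TT_zero n k _ (by omega)]; simp
end

open MvPolynomial in
/-- Lagrange-inversion formula for the weighted count `P_{n,k}(c,d)` of Motzkin
prefixes of length `n` and final height `k` (weight `c` on down steps, `d` on
level steps).  Here `c = X 0` and `d = X 1`. -/
theorem stmt9 (n k : ℕ) (hk : k ≤ n) :
    ((n : MvPolynomial (Fin 2) ℤ) + 1) *
      ∑ P ∈ Finset.univ.filter (fun P : Fin n → Step => IsMPrefix P k),
        (X 0 : MvPolynomial (Fin 2) ℤ) ^ (Finset.univ.filter (fun i => P i = Step.D)).card *
        (X 1) ^ (Finset.univ.filter (fun i => P i = Step.L)).card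
    = ((k : MvPolynomial (Fin 2) ℤ) + 1) *
      ∑ l ∈ (Finset.range (n-k+1)).filter (fun l => n ≤ 2*l + k),
        ((n+1).choose l : MvPolynomial (Fin 2) ℤ) *
        (l.choose (2*l + k - n) : MvPolynomial (Fin 2) ℤ) *
        (X 1) ^ (2*l + k - n) * (X 0) ^ (n - k - l) := by
  have h := main_aux (X 0 : MvPolynomial (Fin 2) ℤ) (X 1) n k hk
  rw [← h, Finset.sum_filter]
  unfold SS
  simp only [wt_prod]
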